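/- Every finite-dimensional real normed space Y has the approximate hyperplane sum property for ℓ∞⁴, i.e., there exists a function γ : (0,1) → (0,1) with 0 < γ(ε) < ε such that Y has the AHSp-ℓ∞⁴ with γ. -/

import Mathlib

/-- `M_Y^4`: quadruples `(y₁,y₂,y₃,y₄)` in the closed unit ball of `Y` such that
`‖y_{i₁} − y_{i₂} + y_{i₃}‖ ≤ 1` for all `i₁ < i₂ < i₃`. -/
def MY4 {Y : Type*} [NormedAddCommGroup Y] (y : Fin 4 → Y) : Prop :=
  (∀ i, ‖y i‖ ≤ 1) ∧
    ∀ i j k : Fin 4, i < j → j < k → ‖y i - y j + y k‖ ≤ 1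

/-- `Y` has the approximate hyperplane sum property for `ℓ∞⁴` with the function `γ`. -/
def AHSpL4With (Y : Type*) [NormedAddCommGroup Y] [NormedSpace ℝ Y] (γ : ℝ → ℝ) : Prop :=
  ∀ ε : ℝ, 0 < ε → ε < 1 →
    (0 < γ ε ∧ γ ε < ε) ∧
    ∀ y : Fin 4 → Y, MY4 y →
      ∀ A : Finset (Fin 4), A.Nonempty →
        ∀ f : Y →L[ℝ] ℝ, ‖f‖ = 1 →
          (∀ i ∈ A, 1 - γ ε < f (y i)) →
          ∃ z : Fin 4 → Y, MY4 z ∧ (∀ i, ‖z i - y i‖ < ε) ∧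
            ‖∑ i ∈ A, z i‖ = (A.card : ℝ)

theorem isCompact_setOf_MY4 (Y : Type*) [NormedAddCommGroup Y] [NormedSpace ℝ Y]
    [FiniteDimensional ℝ Y] : IsCompact {y : Fin 4 → Y | MY4 y} := by
  have : ProperSpace Y := FiniteDimensional.proper ℝ Y
  refine (isCompact_closedBall (0 : Fin 4 → Y) 1).of_isClosed_subset ?_ ?_
  · simp only [MY4, Set.ofPred_and, Set.ofPred_forall]
    refine IsClosed.inter (isClosed_iInter fun i => ?_)
      (isClosed_iInter fun i => isClosed_iInter fun j => isClosed_iInter fun k =>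
        isClosed_iInter fun _ => isClosed_iInter fun _ => ?_)
    all_goals exact isClosed_le (by fun_prop) continuous_const
  · intro y hy
    rw [mem_closedBall_zero_iff, pi_norm_le_iff_of_nonneg zero_le_one]
    exact hy.1

theorem MY4.norm_sum_le {Y : Type*} [NormedAddCommGroup Y] {y : Fin 4 → Y} (hy : MY4 y)
    (A : Finset (Fin 4)) : ‖∑ i ∈ A, y i‖ ≤ A.card := by
  simpa using norm_sum_le_of_le A fun i _ => hy.1 i

/-- By compactness, a quadruple in `M_Y^4` whose sum over `A` is almost as long as possible is
close to a quadruple in `M_Y^4` whose sum over `A` is as long as possible. -/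
theorem exists_pos_forall_MY4_exists_dist_lt (Y : Type*) [NormedAddCommGroup Y]
    [NormedSpace ℝ Y] [FiniteDimensional ℝ Y] {ε : ℝ} (hε : 0 < ε) (A : Finset (Fin 4)) :
    ∃ δ : ℝ, 0 < δ ∧ ∀ y : Fin 4 → Y, MY4 y → (A.card : ℝ) - ‖∑ i ∈ A, y i‖ < δ →
      ∃ z : Fin 4 → Y, MY4 z ∧ dist z y < ε ∧ ‖∑ i ∈ A, z i‖ = (A.card : ℝ) := by
  set T : Set (Fin 4 → Y) := {z | MY4 z ∧ ‖∑ i ∈ A, z i‖ = (A.card : ℝ)}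
  have hfar : IsClosed {y : Fin 4 → Y | ∀ z ∈ T, ε ≤ dist z y} := by
    simp only [Set.ofPred_forall]
    exact isClosed_iInter fun z => isClosed_iInter fun _ =>
      isClosed_le continuous_const (by fun_prop)
  obtain ⟨δ, hδ, h⟩ := ((isCompact_setOf_MY4 Y).inter_right hfar).exists_forall_le'
    (f := fun y => (A.card : ℝ) - ‖∑ i ∈ A, y i‖) (by fun_prop) (a := 0) (by
      rintro y ⟨hy, hyT⟩
      refine sub_pos.2 (lt_of_le_of_ne (MY4.norm_sum_le hy A) fun heq => ?_)
      have := hyT y ⟨hy, heq⟩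
      rw [dist_self] at this
      exact this.not_gt hε)
  refine ⟨δ, hδ, fun y hy hlt => ?_⟩
  by_contra! hne
  refine (h y ⟨hy, fun z hz => ?_⟩).not_gt hlt
  by_contra! hzy
  exact hne z hz.1 hzy hz.2

/-- Every finite-dimensional real normed space has the AHSp-`ℓ∞⁴`. -/
theorem stmt11 (Y : Type*) [NormedAddCommGroup Y] [NormedSpace ℝ Y]
    [FiniteDimensional ℝ Y] :
    ∃ γ : ℝ → ℝ, AHSpL4With Y γ := by
  have key : ∀ ε : ℝ, ∃ δ : ℝ, 0 < ε → 0 < δ ∧ ∀ A : Finset (Fin 4), ∀ y : Fin 4 → Y,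
      MY4 y → (A.card : ℝ) - ‖∑ i ∈ A, y i‖ < δ →
      ∃ z : Fin 4 → Y, MY4 z ∧ dist z y < ε ∧ ‖∑ i ∈ A, z i‖ = (A.card : ℝ) := by
    intro ε
    by_cases hε : 0 < ε
    · choose d hd h using exists_pos_forall_MY4_exists_dist_lt Y hε
      obtain ⟨B, hB⟩ := Finite.exists_min d
      exact ⟨d B, fun _ => ⟨hd B, fun A y hy hlt => h A y hy (hlt.trans_le (hB A))⟩⟩
    · exact ⟨0, fun h => absurd h hε⟩
  choose δ hδ using key
  refine ⟨fun ε => min (ε / 2) (δ ε / 4), fun ε hε _ => ?_⟩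
  obtain ⟨hpos, h⟩ := hδ ε hε
  refine ⟨⟨by positivity, (min_le_left _ _).trans_lt (half_lt_self hε)⟩, ?_⟩
  intro y hy A hA f hf hfy
  have hsum : ∑ _i ∈ A, (1 - δ ε / 4) < ∑ i ∈ A, f (y i) :=
    Finset.sum_lt_sum_of_nonempty hA fun i hi =>
      (sub_le_sub_left (min_le_right _ _) _).trans_lt (hfy i hi)
  rw [Finset.sum_const, nsmul_eq_mul, ← map_sum] at hsum
  have hle : f (∑ i ∈ A, y i) ≤ ‖∑ i ∈ A, y i‖ := by
    simpa [hf] using (le_abs_self _).trans (f.le_opNorm (∑ i ∈ A, y i))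
  have hcard : (A.card : ℝ) ≤ 4 := by
    exact_mod_cast A.card_le_univ
  obtain ⟨z, hz, hzy, hzA⟩ := h A y hy (by nlinarith)
  refine ⟨z, hz, fun i => ?_, hzA⟩
  rw [← dist_eq_norm]
  exact (dist_le_pi_dist z y i).trans_lt hzy
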